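/- For any constant c < 1/4, there is no sequence of intervals of length n^c which contain the chromatic number of G(n,1/2) with high probability. Precisely: for every constant c ∈ (0, 1/4) and every pair of sequences s, t : ℕ → ℝ with t_n − s_n ≤ n^c for all n, it is NOT the case that P(χ(G(n,1/2)) ∈ [s_n, t_n]) → 1 as n → ∞. -/

import Mathlib

open Filter

/-- The chromatic number of a graph on `Fin n`, as a natural number. -/
noncomputable def chi (n : ℕ) (G : SimpleGraph (Fin n)) : ℕ := G.chromaticNumber.toNat

/-- Probability of an event under `G(n,1/2)`, i.e. the uniform measure on all
simple graphs on `{1,…,n}` (each edge present independently with probability 1/2). -/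
noncomputable def Pr (n : ℕ) (B : SimpleGraph (Fin n) → Prop) : ℝ :=
  (Nat.card {G : SimpleGraph (Fin n) // B G} : ℝ) / (Nat.card (SimpleGraph (Fin n)) : ℝ)

set_option linter.unusedSectionVars false

section comb
variable {V W : Type} [Fintype V] [Fintype W]

lemma card_le_graph (H : SimpleGraph V) : Nat.card {G : SimpleGraph V // G ≤ H} = 2 ^ H.edgeSet.ncard := by
  classical
  have e : {G : SimpleGraph V // G ≤ H} ≃ 𝒫 H.edgeSet :=
    { toFun := fun G => ⟨G.1.edgeSet, SimpleGraph.edgeSet_subset_edgeSet.2 G.2⟩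
      invFun := fun S => ⟨SimpleGraph.fromEdgeSet S.1, by
        have h := S.2
        rw [← SimpleGraph.edgeSet_subset_edgeSet, SimpleGraph.edgeSet_fromEdgeSet]
        exact Set.sdiff_subset.trans h⟩
      left_inv := fun G => by simp
      right_inv := fun S => by
        apply Subtype.ext
        have h : S.1 ⊆ H.edgeSet := S.2
        simp only [SimpleGraph.edgeSet_fromEdgeSet]
        ext x
        simp only [Set.mem_sdiff]
        constructor
        · exact fun h => h.1
        · exact fun hx => ⟨hx, H.not_isDiag_of_mem_edgeSet (h hx)⟩ }
  rw [Nat.card_congr e]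
  have := Set.ncard_powerset H.edgeSet (Set.toFinite _)
  rw [← this]; rfl

lemma card_split (H : SimpleGraph V) (B : SimpleGraph V → Prop) (hB : ∀ G, B G ↔ B (G \ H)) :
    Nat.card {G : SimpleGraph V // B G} =
      Nat.card {G : SimpleGraph V // Disjoint G H ∧ B G} * 2 ^ H.edgeSet.ncard := by
  rw [← card_le_graph, ← Nat.card_prod]
  apply Nat.card_congr
  exact
    { toFun := fun G => (⟨G.1 \ H, disjoint_sdiff_self_left, (hB _).1 G.2⟩, ⟨G.1 ⊓ H, inf_le_right⟩)
      invFun := fun p => ⟨p.1.1 ⊔ p.2.1, by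
        rw [hB, sup_sdiff, sdiff_eq_bot_iff.2 p.2.2, sup_bot_eq, ← hB]
        exact p.1.2.2⟩
      left_inv := fun G => by
        apply Subtype.ext
        simp [sup_comm]
      right_inv := fun p => by
        obtain ⟨⟨a, ha, _⟩, ⟨b, hb⟩⟩ := p
        apply Prod.ext
        · apply Subtype.ext
          simp only
          rw [sup_sdiff, sdiff_eq_bot_iff.2 hb, sup_bot_eq, ha.sdiff_eq_left]
        · apply Subtype.ext
          simp only
          rw [inf_sup_right, ha.eq_bot, bot_sup_eq, inf_eq_left.2 hb] }

lemma card_comap_aux (e : W ↪ V) (B : SimpleGraph W → Prop) :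
    Nat.card {G : SimpleGraph V // B (G.comap e)} =
      Nat.card {G : SimpleGraph W // B G} * Nat.card {G : SimpleGraph V // G ≤ ((⊤ : SimpleGraph W).map e)ᶜ} := by
  rw [← Nat.card_prod]
  apply Nat.card_congr
  have hc : ∀ G : SimpleGraph V, G ≤ ((⊤ : SimpleGraph W).map e)ᶜ → G.comap e = ⊥ := by
    intro G hG
    ext u v
    simp only [SimpleGraph.comap_adj, SimpleGraph.bot_adj, iff_false]
    intro h
    have h2 := hG h
    simp only [SimpleGraph.compl_adj] at h2
    apply h2.2
    rw [SimpleGraph.map_adj]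
    exact ⟨u, v, by simpa using fun h' => h2.1 (by rw [h']), rfl, rfl⟩
  exact
    { toFun := fun G => (⟨G.1.comap e, G.2⟩, ⟨G.1 ⊓ ((⊤ : SimpleGraph W).map e)ᶜ, inf_le_right⟩)
      invFun := fun p => ⟨p.1.1.map e ⊔ p.2.1, by
        have : (p.1.1.map e ⊔ p.2.1).comap e = (p.1.1.map e).comap e ⊔ p.2.1.comap e := by
          ext; simp
        rw [this, hc _ p.2.2, SimpleGraph.comap_map_eq, sup_bot_eq]
        exact p.1.2⟩
      left_inv := fun G => by
        apply Subtype.ext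
        ext u v
        simp only [SimpleGraph.sup_adj, SimpleGraph.inf_adj, SimpleGraph.map_adj, SimpleGraph.compl_adj, SimpleGraph.comap_adj, SimpleGraph.top_adj]
        constructor
        · rintro (⟨a, b, h, rfl, rfl⟩ | h)
          · exact h
          · exact h.1
        · intro h
          by_cases h2 : ∃ a b, a ≠ b ∧ e a = u ∧ e b = v
          · obtain ⟨a, b, _, rfl, rfl⟩ := h2
            exact Or.inl ⟨a, b, h, rfl, rfl⟩
          · exact Or.inr ⟨h, h.ne, h2⟩
      right_inv := fun p => by
        obtain ⟨⟨a, ha⟩, ⟨b, hb⟩⟩ := p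
        apply Prod.ext
        · apply Subtype.ext
          simp only
          have : (a.map e ⊔ b).comap e = (a.map e).comap e ⊔ b.comap e := by
            ext; simp
          rw [this, hc _ hb, SimpleGraph.comap_map_eq, sup_bot_eq]
        · apply Subtype.ext
          simp only
          rw [inf_sup_right, inf_eq_left.2 hb]
          have : a.map e ≤ (⊤ : SimpleGraph W).map e := SimpleGraph.map_monotone e le_top
          have h3 : Disjoint (a.map e) ((⊤ : SimpleGraph W).map e)ᶜ := disjoint_compl_right.mono_left this
          rw [h3.eq_bot, bot_sup_eq] }

lemma card_comap (e : W ↪ V) (B : SimpleGraph W → Prop) :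
    Nat.card {G : SimpleGraph V // B (G.comap e)} * Nat.card (SimpleGraph W) =
      Nat.card {G : SimpleGraph W // B G} * Nat.card (SimpleGraph V) := by
  have h1 := card_comap_aux e B
  have h2 := card_comap_aux e (fun _ => True)
  have h3 : Nat.card {G : SimpleGraph V // True} = Nat.card (SimpleGraph V) := Nat.card_congr (Equiv.subtypeUnivEquiv (by simp))
  have h4 : Nat.card {G : SimpleGraph W // True} = Nat.card (SimpleGraph W) := Nat.card_congr (Equiv.subtypeUnivEquiv (by simp))
  rw [h3, h4] at h2
  rw [h1, h2]; ring

/-- clique on S -/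
def cl (S : Finset V) : SimpleGraph V where
  Adj u v := u ≠ v ∧ u ∈ S ∧ v ∈ S
  symm := ⟨fun _ _ h => ⟨h.1.symm, h.2.2, h.2.1⟩⟩
  loopless := ⟨fun _ h => h.1 rfl⟩

end comb

section comb2
variable {V W : Type} [Fintype V] [Fintype W]

open Classical in
lemma cl_edgeSet (S : Finset V) : (cl S).edgeSet = ↑(S.offDiag.image (fun p : V × V => s(p.1, p.2))) := by
  ext x
  induction x using Sym2.ind with
  | _ u v =>
    simp only [cl, SimpleGraph.mem_edgeSet, Finset.coe_image, Set.mem_image, Finset.mem_coe, Finset.mem_offDiag, Prod.exists, Sym2.eq_iff]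
    constructor
    · intro h; exact ⟨u, v, ⟨h.2.1, h.2.2, h.1⟩, Or.inl ⟨rfl, rfl⟩⟩
    · rintro ⟨a, b, h, (⟨rfl, rfl⟩ | ⟨rfl, rfl⟩)⟩
      · exact ⟨h.2.2, h.1, h.2.1⟩
      · exact ⟨h.2.2.symm, h.2.1, h.1⟩

lemma cl_ncard (S : Finset V) : (cl S).edgeSet.ncard = S.card.choose 2 := by
  classical
  rw [cl_edgeSet, Set.ncard_coe_finset]
  exact Sym2.card_image_offDiag S

lemma cl_sup_ncard [DecidableEq V] (S T : Finset V) :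
    (cl S ⊔ cl T).edgeSet.ncard + (S ∩ T).card.choose 2 = S.card.choose 2 + T.card.choose 2 := by
  rw [← cl_ncard, ← cl_ncard, ← cl_ncard, SimpleGraph.edgeSet_sup]
  have : (cl (S ∩ T)).edgeSet = (cl S).edgeSet ∩ (cl T).edgeSet := by
    rw [← SimpleGraph.edgeSet_inf]
    congr 1
    ext u v
    simp [cl]; tauto
  rw [this, Set.ncard_union_add_ncard_inter _ _ (Set.toFinite _) (Set.toFinite _)]

/-- graph of monochromatic pairs -/
def mono {m : ℕ} (f : V → Fin m) : SimpleGraph V where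
  Adj u v := u ≠ v ∧ f u = f v
  symm := ⟨fun _ _ h => ⟨h.1.symm, h.2.symm⟩⟩
  loopless := ⟨fun _ h => h.1 rfl⟩

open Classical in
lemma mono_ncard {m : ℕ} (f : V → Fin m) :
    (mono f).edgeSet.ncard = ∑ i, (Finset.univ.filter (fun v => f v = i)).card.choose 2 := by
  have h : (mono f).edgeSet = ↑(Finset.univ.biUnion (fun i : Fin m => ((Finset.univ.filter (fun v => f v = i)).offDiag.image (fun p : V × V => s(p.1, p.2))))) := by
    ext x
    simp only [Finset.coe_biUnion, ← cl_edgeSet]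
    induction x using Sym2.ind with
    | _ u v =>
    simp [mono, cl]
    intro _
    exact eq_comm
  rw [h, Set.ncard_coe_finset, Finset.card_biUnion]
  · apply Finset.sum_congr rfl
    intro i _
    exact Sym2.card_image_offDiag _
  · intro i _ j _ hij
    show Disjoint (Finset.image _ _) (Finset.image _ _)
    rw [← Finset.disjoint_coe, ← cl_edgeSet, ← cl_edgeSet, SimpleGraph.disjoint_edgeSet]
    rw [disjoint_iff]
    ext u v
    simp [cl]
    intro _ h1 h2 _ h3 _
    exact hij (h1.symm.trans h3)

open Classical in
lemma mono_ncard_ge {m : ℕ} (f : V → Fin m) :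
    (Fintype.card V : ℝ) ^ 2 ≤ m * (2 * (mono f).edgeSet.ncard + Fintype.card V) := by
  rw [mono_ncard]
  set c : Fin m → ℕ := fun i => (Finset.univ.filter (fun v => f v = i)).card with hc
  have h1 : Fintype.card V = ∑ i, c i := by
    rw [← Finset.card_univ, Finset.card_eq_sum_card_fiberwise (f := f) (t := Finset.univ)]
    simp
  have h2 : ((∑ i, (c i : ℝ))) ^ 2 ≤ m * ∑ i, (c i : ℝ) ^ 2 := by
    have := sq_sum_le_card_mul_sum_sq (s := Finset.univ) (f := fun i => (c i : ℝ))
    simpa using this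
  rw [h1]
  push_cast
  have h3 : (2 * ∑ i, ((c i).choose 2 : ℝ) + ∑ i, (c i : ℝ)) = ∑ i, (c i : ℝ) ^ 2 := by
    rw [Finset.mul_sum, ← Finset.sum_add_distrib]
    apply Finset.sum_congr rfl
    intro i _
    rw [Nat.cast_choose_two]; ring
  rw [h3]; exact h2

lemma disj_cl_iff (G : SimpleGraph V) (S : Finset V) : Disjoint G (cl S) ↔ ∀ u ∈ S, ∀ v ∈ S, ¬ G.Adj u v := by
  rw [disjoint_iff]
  constructor
  · intro h u hu v hv huv
    have : (G ⊓ cl S).Adj u v := ⟨huv, huv.ne, hu, hv⟩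
    rw [h] at this; exact this
  · intro h
    ext u v
    simp [cl]
    intro huv _ hu hv
    exact h u hu v hv huv

/-- probability that `G` avoids all edges of `H` -/
lemma card_disj (H : SimpleGraph V) :
    (Nat.card {G : SimpleGraph V // Disjoint G H} : ℝ) * 2 ^ H.edgeSet.ncard = Nat.card (SimpleGraph V) := by
  have h := card_split H (fun _ => True) (by simp)
  have h3 : Nat.card {G : SimpleGraph V // True} = Nat.card (SimpleGraph V) := Nat.card_congr (Equiv.subtypeUnivEquiv (by simp))
  rw [h3] at h
  simp only [and_true] at h
  rw [h]; push_cast; ring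
end comb2

lemma card_graph_pos (n : ℕ) : (0 : ℝ) < Nat.card (SimpleGraph (Fin n)) := by
  have : 0 < Nat.card (SimpleGraph (Fin n)) := Nat.card_pos
  exact_mod_cast this

lemma plant (n k t : ℕ) (S : Finset (Fin (n+k))) (hS : S.card = k) :
    (Nat.card (SimpleGraph (Fin (n+k))) : ℝ) * Pr n (fun G => G.Colorable t) ≤
    (Nat.card {G : SimpleGraph (Fin (n+k)) // Disjoint G (cl S) ∧ G.Colorable (t+1)} : ℝ) * 2 ^ (k.choose 2) := by
  classical
  have hc : (Sᶜ).card = n := by rw [Finset.card_compl, hS]; simp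
  let e : Fin n ↪ Fin (n+k) := ((Sᶜ).orderEmbOfFin hc).toEmbedding
  have he : ∀ i, e i ∉ S := fun i => by
    exact Finset.mem_compl.1 (Finset.orderEmbOfFin_mem (Sᶜ) hc i)
  have he2 : ∀ v, v ∉ S → ∃ i, e i = v := by
    intro v hv
    have := Finset.range_orderEmbOfFin (Sᶜ) hc
    have hv2 : v ∈ ((Sᶜ : Finset _) : Set (Fin (n+k))) := by simpa using hv
    rw [← this] at hv2
    exact hv2
  have h1 := card_split (cl S) (fun G => (G.comap e).Colorable t) (by
    intro G
    have : (G \ cl S).comap e = G.comap e := by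
      ext u v
      simp [cl, he]
    rw [this])
  have h2 := card_comap e (fun G => G.Colorable t)
  have h3 : Nat.card {G : SimpleGraph (Fin (n+k)) // Disjoint G (cl S) ∧ (G.comap e).Colorable t} ≤
      Nat.card {G : SimpleGraph (Fin (n+k)) // Disjoint G (cl S) ∧ G.Colorable (t+1)} := by
    suffices hsuff : ∀ G : SimpleGraph (Fin (n+k)), Disjoint G (cl S) ∧ (G.comap e).Colorable t → G.Colorable (t+1) by
      apply Nat.card_le_card_of_injective (fun G : {G : SimpleGraph (Fin (n+k)) // Disjoint G (cl S) ∧ (G.comap e).Colorable t} => (⟨G.1, G.2.1, hsuff _ G.2⟩ : {G : SimpleGraph (Fin (n+k)) // Disjoint G (cl S) ∧ G.Colorable (t+1)}))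
      intro a b hab
      exact Subtype.ext (Subtype.mk.inj hab)
    · rintro G ⟨hG, hGc⟩
      obtain ⟨f⟩ := hGc
      have hg' : ∀ v, ∃ g : Option (Fin t), ∀ i, e i = v → g = some (f i) := by
        intro v
        by_cases hv : ∃ i, e i = v
        · obtain ⟨i, hi⟩ := hv
          exact ⟨some (f i), fun j hj => by rw [e.injective (hj.trans hi.symm)]⟩
        · exact ⟨none, fun i hi => absurd ⟨i, hi⟩ hv⟩
      choose g hg using hg'
      have hcol : (G.Coloring (Option (Fin t))) := SimpleGraph.Coloring.mk (fun v => if v ∈ S then none else g v) (by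
        intro u v huv
        rw [disj_cl_iff] at hG
        by_cases hu : u ∈ S <;> by_cases hv : v ∈ S
        · exact absurd huv (hG u hu v hv)
        · obtain ⟨i, hi⟩ := he2 v hv
          simp [hu, hv, hg v i hi]
        · obtain ⟨i, hi⟩ := he2 u hu
          simp [hu, hv, hg u i hi]
        · obtain ⟨i, hi⟩ := he2 v hv
          obtain ⟨j, hj⟩ := he2 u hu
          simp only [hu, hv, if_false, hg v i hi, hg u j hj]
          have : f j ≠ f i := f.valid (by
            rw [SimpleGraph.comap_adj, hi, hj]; exact huv)
          simpa using this)
      have := hcol.colorable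
      simpa using this
  rw [cl_ncard, hS] at h1
  have hn := card_graph_pos n
  have h4 : (Nat.card (SimpleGraph (Fin (n+k))) : ℝ) * Pr n (fun G => G.Colorable t) =
     Nat.card {G : SimpleGraph (Fin (n+k)) // (G.comap e).Colorable t} := by
    unfold Pr
    field_simp
    have : ((Nat.card {G : SimpleGraph (Fin (n+k)) // (G.comap e).Colorable t} * Nat.card (SimpleGraph (Fin n)) : ℕ) : ℝ) = _ := congrArg _ h2
    push_cast at this
    linarith
  rw [h4, h1]
  push_cast
  gcongr

noncomputable def Wsum (N k : ℕ) : ℝ :=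
  ∑ S ∈ Finset.powersetCard k (Finset.univ : Finset (Fin N)),
    ∑ T ∈ Finset.powersetCard k (Finset.univ : Finset (Fin N)), ((2:ℝ) ^ ((S ∩ T).card.choose 2) - 1)

lemma card_sum {α : Type} [Fintype α] (P : α → Prop) [DecidablePred P] :
    (Nat.card {a // P a} : ℝ) = ∑ a, if P a then (1:ℝ) else 0 := by
  rw [Nat.card_eq_fintype_card, Fintype.card_subtype]
  simp

lemma step (n k t : ℕ) :
    Pr n (fun G => G.Colorable t) ≤ Pr (n+k) (fun G => G.Colorable (t+1)) +
      Real.sqrt (Wsum (n+k) k / ((n+k).choose k) ^ 2) := by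
  classical
  set Ω : ℝ := (Nat.card (SimpleGraph (Fin (n+k))) : ℝ) with hΩ
  have hΩ0 : 0 < Ω := card_graph_pos _
  have hΩs : ∑ G : SimpleGraph (Fin (n+k)), (1:ℝ) = Ω := by
    simp [hΩ, Nat.card_eq_fintype_card]
  set M : ℝ := (((n+k).choose k : ℕ) : ℝ) with hM
  have hM0 : 0 < M := by
    have : 0 < (n+k).choose k := Nat.choose_pos (by omega)
    rw [hM]; exact_mod_cast this
  set D : ℝ := 2 ^ (k.choose 2) with hD
  have hD0 : 0 < D := by positivity
  set q : ℝ := 1 / D with hq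
  have hq0 : 0 < q := by positivity
  set P := Finset.powersetCard k (Finset.univ : Finset (Fin (n+k))) with hP
  have hPc : (P.card : ℝ) = M := by simp [hP, hM]
  let a : Finset (Fin (n+k)) → SimpleGraph (Fin (n+k)) → ℝ := fun S G => if Disjoint G (cl S) then 1 else 0
  let b : SimpleGraph (Fin (n+k)) → ℝ := fun G => if G.Colorable (t+1) then 1 else 0
  have ha : ∀ S ∈ P, ∑ G, a S G = q * Ω := by
    intro S hS
    have hS' : S.card = k := (Finset.mem_powersetCard.1 hS).2
    have := card_disj (cl S)
    rw [cl_ncard, hS', card_sum] at this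
    rw [hΩ, ← this, hq]
    field_simp
    rfl
  have haa : ∀ S ∈ P, ∀ T ∈ P, ∑ G, a S G * a T G = q ^ 2 * 2 ^ ((S ∩ T).card.choose 2) * Ω := by
    intro S hS T hT
    have hS' : S.card = k := (Finset.mem_powersetCard.1 hS).2
    have hT' : T.card = k := (Finset.mem_powersetCard.1 hT).2
    have h1 := card_disj (cl S ⊔ cl T)
    have h2 := cl_sup_ncard S T
    rw [hS', hT'] at h2
    have h3 : (2:ℝ) ^ ((cl S ⊔ cl T).edgeSet.ncard) * 2 ^ ((S ∩ T).card.choose 2) = D * D := by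
      rw [← pow_add, h2, pow_add]
    rw [card_sum] at h1
    have h4 : ∑ G, a S G * a T G = ∑ G : SimpleGraph (Fin (n+k)), if Disjoint G (cl S ⊔ cl T) then (1:ℝ) else 0 := by
      apply Finset.sum_congr rfl
      intro G _
      simp only [a, disjoint_sup_right]
      by_cases h1 : Disjoint G (cl S) <;> by_cases h2 : Disjoint G (cl T) <;> simp [h1, h2]
    rw [h4, hΩ, ← h1]
    set x := ∑ G : SimpleGraph (Fin (n+k)), if Disjoint G (cl S ⊔ cl T) then (1:ℝ) else 0
    calc x = x * (D * D) * q ^ 2 := by rw [hq]; field_simp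
      _ = _ := by rw [← h3]; ring
  let Y : SimpleGraph (Fin (n+k)) → ℝ := fun G => ∑ S ∈ P, (a S G - q)
  have hY2 : ∑ G, Y G ^ 2 = Ω * q ^ 2 * Wsum (n+k) k := by
    have : ∀ G, Y G ^ 2 = ∑ S ∈ P, ∑ T ∈ P, (a S G * a T G - q * a S G - q * a T G + q ^ 2) := by
      intro G
      simp only [Y]
      rw [sq, Finset.sum_mul_sum]
      apply Finset.sum_congr rfl; intro S _
      apply Finset.sum_congr rfl; intro T _
      ring
    simp_rw [this]
    rw [Finset.sum_comm]
    unfold Wsum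
    rw [Finset.mul_sum]
    apply Finset.sum_congr rfl; intro S hS
    rw [Finset.sum_comm, Finset.mul_sum]
    apply Finset.sum_congr rfl; intro T hT
    rw [Finset.sum_add_distrib, Finset.sum_sub_distrib, Finset.sum_sub_distrib, ← Finset.mul_sum, ← Finset.mul_sum,
      ha S hS, ha T hT, haa S hS T hT]
    have : ∑ G : SimpleGraph (Fin (n+k)), q ^ 2 = q ^ 2 * Ω := by
      rw [← hΩs, Finset.mul_sum]; simp
    rw [this]; ring
  have hp : ∑ G, b G = Ω * Pr (n+k) (fun G => G.Colorable (t+1)) := by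
    unfold Pr
    rw [card_sum, ← hΩ]
    field_simp
    rfl
  have hlow : M * q * Ω * Pr n (fun G => G.Colorable t) ≤ ∑ G, b G * ∑ S ∈ P, a S G := by
    have h1 : ∑ G, b G * ∑ S ∈ P, a S G = ∑ S ∈ P, ∑ G, b G * a S G := by
      simp_rw [Finset.mul_sum]
      rw [Finset.sum_comm]
    rw [h1]
    have h2 : ∀ S ∈ P, q * Ω * Pr n (fun G => G.Colorable t) ≤ ∑ G, b G * a S G := by
      intro S hS
      have hS' : S.card = k := (Finset.mem_powersetCard.1 hS).2
      have h3 := plant n k t S hS'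
      rw [card_sum] at h3
      have h4 : ∑ G, b G * a S G = ∑ G : SimpleGraph (Fin (n+k)), if Disjoint G (cl S) ∧ G.Colorable (t+1) then (1:ℝ) else 0 := by
        apply Finset.sum_congr rfl
        intro G _
        simp only [a, b]
        by_cases h1 : Disjoint G (cl S) <;> by_cases h2 : G.Colorable (t+1) <;> simp [h1, h2]
      rw [h4]
      set x := ∑ G : SimpleGraph (Fin (n+k)), if Disjoint G (cl S) ∧ G.Colorable (t+1) then (1:ℝ) else 0
      calc _ = q * (Ω * Pr n (fun G => G.Colorable t)) := by ring
        _ ≤ q * (x * D) := by gcongr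
        _ = x := by rw [hq]; field_simp
    have h5 := Finset.card_nsmul_le_sum P _ _ h2
    rw [nsmul_eq_mul, hPc] at h5
    linarith
  have hsplit : ∑ G, b G * ∑ S ∈ P, a S G = ∑ G, b G * Y G + M * q * ∑ G, b G := by
    rw [Finset.mul_sum, ← Finset.sum_add_distrib]
    apply Finset.sum_congr rfl
    intro G _
    simp only [Y]
    rw [Finset.sum_sub_distrib, Finset.sum_const, nsmul_eq_mul, hPc]
    ring
  have hb2 : ∑ G, b G ^ 2 ≤ Ω := by
    rw [← hΩs]
    apply Finset.sum_le_sum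
    intro G _
    simp only [b]
    split_ifs <;> simp
  have hCS : (∑ G, b G * Y G) ^ 2 ≤ (Ω * q) ^ 2 * Wsum (n+k) k := by
    refine (Finset.sum_mul_sq_le_sq_mul_sq _ _ _).trans ?_
    rw [hY2]
    have : 0 ≤ Ω * q ^ 2 * Wsum (n+k) k := by rw [← hY2]; positivity
    calc _ ≤ Ω * (Ω * q ^ 2 * Wsum (n+k) k) := by gcongr
      _ = _ := by ring
  have hCS2 : ∑ G, b G * Y G ≤ Ω * q * M * Real.sqrt (Wsum (n+k) k / M ^ 2) := by
    have h1 : ∑ G, b G * Y G ≤ Real.sqrt ((Ω * q) ^ 2 * Wsum (n+k) k) := Real.le_sqrt_of_sq_le hCS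
    rw [Real.sqrt_mul (by positivity), Real.sqrt_sq (by positivity)] at h1
    rw [Real.sqrt_div' _ (by positivity), Real.sqrt_sq hM0.le]
    calc _ ≤ _ := h1
      _ = _ := by field_simp
  have hfin : M * q * Ω * Pr n (fun G => G.Colorable t) ≤ M * q * Ω * (Pr (n+k) (fun G => G.Colorable (t+1)) + Real.sqrt (Wsum (n+k) k / M ^ 2)) := by
    rw [hsplit, hp] at hlow
    linarith
  exact le_of_mul_le_mul_left hfin (by positivity)

lemma Wsum_le (n k : ℕ) : Wsum (n+k) k / ((n+k).choose k) ^ 2 ≤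
    ∑ l ∈ Finset.Icc 2 k, (k.choose l : ℝ) * (n.choose (k-l)) * 2 ^ (l.choose 2) / ((n+k).choose k) := by
  set P := Finset.powersetCard k (Finset.univ : Finset (Fin (n+k))) with hP
  have hM0 : (0:ℝ) < ((n+k).choose k : ℕ) := by
    have : 0 < (n+k).choose k := Nat.choose_pos (by omega)
    exact_mod_cast this
  have hS : ∀ S ∈ P, ∑ T ∈ P, ((2:ℝ) ^ ((S ∩ T).card.choose 2) - 1) ≤
      ∑ l ∈ Finset.Icc 2 k, (k.choose l : ℝ) * (n.choose (k-l)) * 2 ^ (l.choose 2) := by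
    intro S hS
    have hS' : S.card = k := (Finset.mem_powersetCard.1 hS).2
    have h1 : ∑ T ∈ P, ((2:ℝ) ^ ((S ∩ T).card.choose 2) - 1) ≤
        ∑ T ∈ P.filter (fun T => (S ∩ T).card ∈ Finset.Icc 2 k), (2:ℝ) ^ ((S ∩ T).card.choose 2) := by
      rw [Finset.sum_filter]
      apply Finset.sum_le_sum
      intro T hT
      split_ifs with h
      · linarith
      · have : (S ∩ T).card ≤ k := (Finset.card_le_card Finset.inter_subset_left).trans hS'.le
        have : (S ∩ T).card < 2 := by
          simp only [Finset.mem_Icc] at h; omega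
        rw [Nat.choose_eq_zero_of_lt this]; simp
    refine h1.trans ?_
    rw [← Finset.sum_fiberwise_of_maps_to (s := P.filter (fun T => (S ∩ T).card ∈ Finset.Icc 2 k)) (t := Finset.Icc 2 k) (g := fun T => (S ∩ T).card) (by
      intro T hT; exact (Finset.mem_filter.1 hT).2)]
    apply Finset.sum_le_sum
    intro l hl
    have h2 : ∀ T ∈ (P.filter (fun T => (S ∩ T).card ∈ Finset.Icc 2 k)).filter (fun T => (S ∩ T).card = l), (2:ℝ) ^ ((S ∩ T).card.choose 2) = 2 ^ (l.choose 2) := by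
      intro T hT
      rw [(Finset.mem_filter.1 hT).2]
    rw [Finset.sum_congr rfl h2, Finset.sum_const, nsmul_eq_mul]
    gcongr
    have h3 : ((P.filter (fun T => (S ∩ T).card ∈ Finset.Icc 2 k)).filter (fun T => (S ∩ T).card = l)).card ≤
        (Finset.powersetCard l S ×ˢ Finset.powersetCard (k-l) Sᶜ).card := by
      apply Finset.card_le_card_of_injOn (fun T => (S ∩ T, T \ S))
      · intro T hT
        simp only [Finset.coe_filter, Finset.mem_filter, Set.mem_ofPred_eq, hP, Finset.mem_powersetCard] at hT
        simp only [Finset.coe_product, Set.mem_prod, Finset.mem_coe, Finset.mem_powersetCard]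
        refine ⟨⟨Finset.inter_subset_left, hT.2⟩, ?_, ?_⟩
        · intro x hx; simp at hx ⊢; exact hx.2
        · have := Finset.card_sdiff_add_card_inter T S
          rw [Finset.inter_comm, hT.2, hT.1.1.2] at this
          omega
      · intro T _ T' _ h
        simp only [Prod.mk.injEq] at h
        rw [← Finset.sdiff_union_inter T S, ← Finset.sdiff_union_inter T' S, h.2, Finset.inter_comm T, Finset.inter_comm T', h.1]
    rw [Finset.card_product, Finset.card_powersetCard, Finset.card_powersetCard, hS', Finset.card_compl, hS', Fintype.card_fin, Nat.add_sub_cancel] at h3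
    exact_mod_cast h3
  have h6 := Finset.sum_le_card_nsmul P _ _ hS
  have hPc : (P.card : ℝ) = ((n+k).choose k : ℕ) := by simp [hP]
  rw [nsmul_eq_mul, hPc] at h6
  rw [← Finset.sum_div, div_le_div_iff₀ (by positivity) (by positivity)]
  have h7 : Wsum (n+k) k ≤ _ := h6
  nlinarith

lemma surj_coloring {V : Type} [Fintype V] (G : SimpleGraph V) (m : ℕ) (hm : m ≤ Fintype.card V)
    (h : G.Colorable m) : ∃ f : V → Fin m, Function.Surjective f ∧ ∀ u v, G.Adj u v → f u ≠ f v := by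
  classical
  obtain ⟨f0⟩ := h
  let F : Finset (V → Fin m) := Finset.univ.filter (fun f => ∀ u v, G.Adj u v → f u ≠ f v)
  have hF : F.Nonempty := ⟨f0, by simp only [F, Finset.mem_filter, Finset.mem_univ, true_and]; exact fun u v h => f0.valid h⟩
  obtain ⟨f, hf, hmax⟩ := Finset.exists_max_image F (fun f => (Finset.univ.image f).card) hF
  have hfp : ∀ u v, G.Adj u v → f u ≠ f v := (Finset.mem_filter.1 hf).2
  refine ⟨f, ?_, hfp⟩
  by_contra hns
  have hns' : ∃ c, ∀ v, f v ≠ c := by simpa [Function.Surjective] using hns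
  obtain ⟨c, hc⟩ := hns'
  have hninj : ¬ Function.Injective f := by
    intro hinj
    have h1 : Fintype.card V < Fintype.card (Fin m) := Fintype.card_lt_of_injective_of_notMem f hinj (b := c) (by simpa using hc)
    simp at h1; omega
  have hninj' : ∃ u v, f u = f v ∧ u ≠ v := by simpa [Function.Injective] using hninj
  obtain ⟨u, v, huv, hne⟩ := hninj'
  let g := Function.update f u c
  have hg : g ∈ F := by
    simp only [F, Finset.mem_filter, Finset.mem_univ, true_and, g]
    intro a b hab
    by_cases ha : a = u <;> by_cases hb : b = u
    · subst ha; subst hb; exact absurd hab (G.loopless.irrefl _)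
    · subst ha; simp only [Function.update_self, Function.update_of_ne hb]; exact (hc b).symm
    · subst hb; simp only [Function.update_self, Function.update_of_ne ha]; exact (hc a)
    · simp only [Function.update_of_ne ha, Function.update_of_ne hb]; exact hfp a b hab
  have hlt : (Finset.univ.image f).card < (Finset.univ.image g).card := by
    apply Finset.card_lt_card
    rw [Finset.ssubset_iff]
    refine ⟨c, by simpa using hc, ?_⟩
    intro x hx
    rw [Finset.mem_insert] at hx
    rcases hx with rfl | hx
    · exact Finset.mem_image.2 ⟨u, Finset.mem_univ _, by simp [g]⟩
    · obtain ⟨a, _, rfl⟩ := Finset.mem_image.1 hx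
      by_cases ha : a = u
      · subst ha
        exact Finset.mem_image.2 ⟨v, Finset.mem_univ _, by simp only [g]; rw [Function.update_of_ne hne.symm, huv]⟩
      · exact Finset.mem_image.2 ⟨a, Finset.mem_univ _, by simp only [g]; rw [Function.update_of_ne ha]⟩
  have := hmax g hg
  omega

lemma disj_mono_iff {V : Type} {m : ℕ} (G : SimpleGraph V) (f : V → Fin m) :
    Disjoint G (mono f) ↔ ∀ u v, G.Adj u v → f u ≠ f v := by
  rw [disjoint_iff]
  constructor
  · intro h u v huv hf
    have : (G ⊓ mono f).Adj u v := ⟨huv, huv.ne, hf⟩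
    rw [h] at this; exact this
  · intro h
    ext u v
    simp [mono]
    intro huv _ 
    exact h u v huv

lemma first_moment (N m : ℕ) (hm0 : 0 < m) (hm : m ≤ N) :
    Pr N (fun G => G.Colorable m) * m.factorial ≤
      (m:ℝ) ^ N * (2:ℝ) ^ (-(((N:ℝ) ^ 2 / m - N) / 2)) := by
  classical
  set Ω : ℝ := (Nat.card (SimpleGraph (Fin N)) : ℝ) with hΩ
  have hΩ0 : 0 < Ω := card_graph_pos _
  let a : (Fin N → Fin m) → SimpleGraph (Fin N) → ℝ := fun f G => if Disjoint G (mono f) then 1 else 0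
  have hup : ∑ G, ∑ f, a f G ≤ (m:ℝ) ^ N * ((2:ℝ) ^ (-(((N:ℝ) ^ 2 / m - N) / 2)) * Ω) := by
    rw [Finset.sum_comm]
    have h1 : ∀ f ∈ (Finset.univ : Finset (Fin N → Fin m)), ∑ G, a f G ≤ (2:ℝ) ^ (-(((N:ℝ) ^ 2 / m - N) / 2)) * Ω := by
      intro f _
      have h2 := card_disj (mono f)
      rw [card_sum] at h2
      have h3 := mono_ncard_ge f
      rw [Fintype.card_fin] at h3
      have h4 : ∑ G, a f G = (2:ℝ) ^ (-((mono f).edgeSet.ncard : ℝ)) * Ω := by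
        rw [Real.rpow_neg (by norm_num), Real.rpow_natCast, hΩ, ← h2]
        field_simp
        rfl
      rw [h4]
      gcongr
      · norm_num
      · have hm' : (0:ℝ) < m := by exact_mod_cast hm0
        have : (N:ℝ) ^ 2 / m ≤ 2 * (mono f).edgeSet.ncard + N := by
          rw [div_le_iff₀ hm']; linarith
        linarith
    have h5 := Finset.sum_le_card_nsmul _ _ _ h1
    rw [nsmul_eq_mul] at h5
    simpa using h5
  have hlow : (∑ G : SimpleGraph (Fin N), if G.Colorable m then (1:ℝ) else 0) * m.factorial ≤ ∑ G, ∑ f, a f G := by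
    rw [Finset.sum_mul]
    apply Finset.sum_le_sum
    intro G _
    split_ifs with hG
    · obtain ⟨f, hfs, hf⟩ := surj_coloring G m (by simpa using hm) hG
      rw [one_mul]
      have h1 : ∑ f, a f G = ((Finset.univ.filter (fun f : Fin N → Fin m => Disjoint G (mono f))).card : ℝ) := by
        simp [a]
      rw [h1]
      have h2 : (Finset.univ : Finset (Equiv.Perm (Fin m))).card ≤ (Finset.univ.filter (fun f : Fin N → Fin m => Disjoint G (mono f))).card := by
        apply Finset.card_le_card_of_injOn (fun σ : Equiv.Perm (Fin m) => (σ : Fin m → Fin m) ∘ f)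
        · intro σ _
          simp only [Finset.coe_filter, Finset.mem_univ, true_and, Set.mem_ofPred_eq]
          rw [disj_mono_iff]
          intro u v huv h
          exact hf u v huv (σ.injective h)
        · intro σ _ τ _ h
          ext x
          obtain ⟨v, rfl⟩ := hfs x
          exact congrArg Fin.val (congrFun h v)
      rw [Finset.card_univ, Fintype.card_perm, Fintype.card_fin] at h2
      exact_mod_cast h2
    · rw [zero_mul]
      apply Finset.sum_nonneg
      intro f _
      simp only [a]; split_ifs <;> simp
  have hfin := hlow.trans hup
  unfold Pr
  rw [card_sum, ← hΩ, div_mul_eq_mul_div, div_le_iff₀ hΩ0]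
  linarith

/-- `2^(1/8)` -/
noncomputable def Qc : ℝ := (2:ℝ) ^ (1/8 : ℝ)

lemma Qc_pos : 0 < Qc := by unfold Qc; positivity
lemma Qc_pow : Qc ^ 8 = 2 := by
  unfold Qc
  rw [← Real.rpow_natCast, ← Real.rpow_mul (by norm_num)]
  norm_num
lemma Qc_gt : 1 < Qc := by
  unfold Qc
  apply Real.one_lt_rpow <;> norm_num

lemma fact_le (k : ℕ) (hk : 1 ≤ k) : (k.factorial : ℝ) ≤ Real.exp 1 * k * ((k:ℝ) / Real.exp 1) ^ k := by
  induction k, hk using Nat.le_induction with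
  | base => simp
  | succ k hk ih =>
    have hk0 : (0:ℝ) < k := by exact_mod_cast hk
    rw [Nat.factorial_succ]
    push_cast
    have h1 : Real.exp 1 * (k:ℝ) ^ (k+1) ≤ ((k:ℝ)+1) ^ (k+1) := by
      have h2 : Real.exp 1 ≤ (((k:ℝ)+1)/k) ^ (k+1) := by
        have h3 : 1 / ((k:ℝ)+1) ≤ Real.log (((k:ℝ)+1)/k) := by
          have := Real.one_sub_inv_le_log_of_pos (x := ((k:ℝ)+1)/k) (by positivity)
          refine le_trans (le_of_eq ?_) this
          field_simp; ring
        rw [← Real.le_log_iff_exp_le (by positivity), Real.log_pow]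
        push_cast
        calc (1:ℝ) = ((k:ℝ)+1) * (1 / ((k:ℝ)+1)) := by field_simp
          _ ≤ _ := by gcongr
      rw [div_pow, le_div_iff₀ (by positivity)] at h2
      exact h2
    calc ((k:ℝ)+1) * k.factorial ≤ ((k:ℝ)+1) * (Real.exp 1 * k * ((k:ℝ) / Real.exp 1) ^ k) := by gcongr
      _ = ((k:ℝ)+1) * (Real.exp 1 * (k:ℝ)^(k+1)) / (Real.exp 1)^k := by rw [div_pow, pow_succ]; field_simp
      _ ≤ ((k:ℝ)+1) * (((k:ℝ)+1) ^ (k+1)) / (Real.exp 1)^k := by gcongr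
      _ = _ := by rw [div_pow, pow_succ (Real.exp 1)]; field_simp

lemma choose_two_mul (l : ℕ) : 2 * l.choose 2 = l * (l - 1) := by
  rw [Nat.choose_two_right]
  exact Nat.mul_div_cancel' (Nat.even_mul_pred_self l).two_dvd

lemma two_pow_choose (l : ℕ) : (2:ℝ) ^ (l.choose 2) = (Qc ^ (4 * (l - 1))) ^ l := by
  rw [← Qc_pow, ← pow_mul, ← pow_mul]
  congr 1
  have := choose_two_mul l
  have h2 : 4 * (l-1) * l = 4 * (l * (l-1)) := by ring
  rw [h2]; omega

lemma poly_small (a : ℕ) (C x : ℝ) (hx : 0 ≤ x) (hx1 : x < 1) (e : ℝ) (he : 0 < e) :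
    ∀ᶠ k : ℕ in atTop, C * (k:ℝ) ^ a * x ^ k ≤ e := by
  have h := (tendsto_pow_const_mul_const_pow_of_lt_one a hx hx1).const_mul C
  rw [mul_zero] at h
  filter_upwards [h.eventually (eventually_le_nhds he)] with k hk
  simpa [mul_assoc] using hk

lemma small_term (n k l : ℕ) (hl2 : 2 ≤ l) (hl : 2 * l ≤ k) (hn : (0.3:ℝ) * k * Qc ^ (4*k) ≤ n)
    (hk : 4 * (k:ℝ) / Qc ^ (2*k) ≤ 1) :
    (k.choose l : ℝ) * (n.choose (k-l)) * 2 ^ (l.choose 2) / ((n+k).choose k) ≤ (4 * (k:ℝ) / Qc ^ (2*k)) ^ 2 := by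
  have hQ := Qc_pos
  have hk0 : (0:ℝ) < k := by exact_mod_cast (by omega : 0 < k)
  have hn0 : (0:ℝ) < n := lt_of_lt_of_le (by positivity) hn
  have hNl : (0:ℝ) < ((n+k).choose l : ℕ) := by exact_mod_cast Nat.choose_pos (by omega)
  have hNk : (0:ℝ) < ((n+k).choose k : ℕ) := by exact_mod_cast Nat.choose_pos (by omega)
  have h1 : (n.choose (k-l) : ℝ) / ((n+k).choose k) ≤ (k.choose l) / ((n+k).choose l) := by
    rw [div_le_div_iff₀ hNk hNl]
    have h2 := Nat.choose_mul (n := n+k) (k := k) (s := l) (by omega)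
    have h3 : n.choose (k-l) ≤ (n+k-l).choose (k-l) := Nat.choose_le_choose _ (by omega)
    have : n.choose (k-l) * (n+k).choose l ≤ k.choose l * (n+k).choose k := by
      calc _ ≤ (n+k-l).choose (k-l) * (n+k).choose l := Nat.mul_le_mul_right _ h3
        _ = _ := by rw [mul_comm, ← h2, mul_comm]
    exact_mod_cast this
  have h4 : (k.choose l : ℝ) / ((n+k).choose l) ≤ (k:ℝ)^l / (n:ℝ)^l := by
    have h5 : (k.choose l : ℝ) ≤ (k:ℝ)^l / l.factorial := Nat.choose_le_pow_div l k
    have h6 : ((n+k+1-l : ℕ):ℝ)^l / l.factorial ≤ ((n+k).choose l : ℕ) := Nat.pow_le_choose l (n+k)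
    have h7 : (n:ℝ)^l / l.factorial ≤ ((n+k).choose l : ℕ) := by
      refine le_trans ?_ h6
      gcongr
      omega
    have hf : (0:ℝ) < l.factorial := by exact_mod_cast Nat.factorial_pos l
    calc _ ≤ ((k:ℝ)^l / l.factorial) / ((n:ℝ)^l / l.factorial) := by gcongr
      _ = _ := by field_simp
  have h8 : (k.choose l : ℝ) ≤ (k:ℝ)^l := by exact_mod_cast Nat.choose_le_pow k l
  have h9 : (2:ℝ) ^ (l.choose 2) ≤ (Qc ^ (2*k)) ^ l := by
    rw [two_pow_choose]
    apply pow_le_pow_left₀ (by positivity)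
    apply pow_le_pow_right₀ Qc_gt.le
    omega
  calc (k.choose l : ℝ) * (n.choose (k-l)) * 2 ^ (l.choose 2) / ((n+k).choose k)
      = (k.choose l : ℝ) * ((n.choose (k-l) : ℝ) / ((n+k).choose k)) * 2 ^ (l.choose 2) := by ring
    _ ≤ (k:ℝ)^l * ((k:ℝ)^l / (n:ℝ)^l) * (Qc ^ (2*k)) ^ l := by
        have h14 := h1.trans h4
        apply mul_le_mul (mul_le_mul h8 h14 (by positivity) (by positivity)) h9 (by positivity) (by positivity)
    _ = ((k:ℝ) * (k / n) * Qc ^ (2*k)) ^ l := by rw [mul_pow, mul_pow, div_pow]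
    _ ≤ (4 * (k:ℝ) / Qc ^ (2*k)) ^ l := by
        gcongr
        rw [mul_div_assoc', div_mul_eq_mul_div, div_le_div_iff₀ hn0 (by positivity)]
        have : Qc ^ (4*k) = Qc ^ (2*k) * Qc ^ (2*k) := by rw [← pow_add]; congr 1; ring
        rw [this] at hn
        have h10 : (4 * (k:ℝ)) * (0.3 * k * (Qc ^ (2*k) * Qc ^ (2*k))) ≤ 4 * k * n := by gcongr
        have h11 : 0 ≤ (k:ℝ) * k * (Qc ^ (2*k) * Qc ^ (2*k)) := by positivity
        nlinarith
    _ ≤ _ := pow_le_pow_of_le_one (by positivity) hk hl2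

lemma inv_mu (n k : ℕ) (hk : 1 ≤ k) (hn : (0.841:ℝ) / Real.exp 1 * k * Qc ^ (4*k) ≤ n) :
    (2:ℝ) ^ (k.choose 2) / ((n+k).choose k) ≤ Real.exp 1 * k / Qc ^ (2*k) := by
  have hQ := Qc_pos
  have hk0 : (0:ℝ) < k := by exact_mod_cast hk
  have hn0 : (0:ℝ) < n := lt_of_lt_of_le (by positivity) hn
  have h6 : ((n+k+1-k : ℕ):ℝ)^k / k.factorial ≤ ((n+k).choose k : ℕ) := Nat.pow_le_choose k (n+k)
  have hf : (0:ℝ) < k.factorial := by exact_mod_cast Nat.factorial_pos k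
  have h7 : (n:ℝ)^k / k.factorial ≤ ((n+k).choose k : ℕ) := by
    refine le_trans ?_ h6
    gcongr
    omega
  have h8 : ((1 / Qc ^ 2) / Real.exp 1 * k * Qc ^ (4*k)) ≤ n := by
    refine le_trans ?_ hn
    gcongr
    rw [div_le_iff₀ (by positivity)]
    have h := Qc_pow
    by_contra hcon
    push Not at hcon
    have : ((0.841:ℝ) * Qc^2)^4 < 1 := pow_lt_one₀ (by positivity) hcon (by norm_num)
    have h2 : ((0.841:ℝ) * Qc^2)^4 = 0.841^4 * Qc^8 := by ring
    rw [h2, h] at this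
    norm_num at this
  have h9 : (2:ℝ) ^ (k.choose 2) = (Qc ^ (4*k))^k / Qc^(4*k) := by
    rw [two_pow_choose, eq_div_iff (by positivity), ← pow_mul, ← pow_mul, ← pow_add]
    congr 1
    obtain ⟨j, rfl⟩ : ∃ j, k = j + 1 := ⟨k-1, by omega⟩
    simp only [Nat.add_sub_cancel]; ring
  calc (2:ℝ) ^ (k.choose 2) / ((n+k).choose k) ≤ ((Qc ^ (4*k))^k / Qc^(4*k)) / (((1 / Qc ^ 2) / Real.exp 1 * k * Qc ^ (4*k))^k / (Real.exp 1 * k * ((k:ℝ) / Real.exp 1) ^ k)) := by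
        rw [h9]
        gcongr
        refine le_trans ?_ h7
        gcongr
        exact fact_le k hk
    _ = (Real.exp 1 * k) * (Qc^(2*k) / Qc^(4*k)) := by
        rw [mul_pow, mul_pow, div_pow, div_pow, div_pow, one_pow, pow_mul Qc 2 k]
        field_simp
    _ = _ := by
        have : Qc ^ (4*k) = Qc ^ (2*k) * Qc ^ (2*k) := by rw [← pow_add]; congr 1; ring
        rw [this]; field_simp

lemma big_term (n k l : ℕ) (hlk : l ≤ k) (hl : k < 2 * l) (hn : (n:ℝ) ≤ 2 * k * Qc ^ (4*k))
    (hk : 2 * (k:ℝ)^2 * Qc^2 / Qc ^ (2*k) ≤ 1) :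
    (k.choose l : ℝ) * (n.choose (k-l)) * 2 ^ (l.choose 2) / ((n+k).choose k) ≤ (2:ℝ) ^ (k.choose 2) / ((n+k).choose k) := by
  have hQ := Qc_pos
  gcongr
  obtain ⟨j, rfl⟩ : ∃ j, k = l + j := ⟨k - l, by omega⟩
  rw [Nat.choose_symm_add, Nat.add_sub_cancel_left]
  have h1 : (2:ℝ) ^ ((l+j).choose 2) = 2 ^ (l.choose 2) * (Qc ^ (4 * (2*l + j - 1))) ^ j := by
    rw [← Qc_pow, ← pow_mul, ← pow_mul, ← pow_mul, ← pow_add]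
    congr 1
    rcases l with _ | l
    · omega
    rcases j with _ | j
    · simp
    have h1 := choose_two_mul (l+1+(j+1))
    have h2 := choose_two_mul (l+1)
    have e1 : l+1+(j+1) - 1 = l + j + 1 := by omega
    have e2 : 2*(l+1)+(j+1)-1 = 2*l + j + 2 := by omega
    rw [e1] at h1
    rw [Nat.add_sub_cancel] at h2
    rw [e2]
    nlinarith
  have h2 : ((l+j).choose j : ℝ) ≤ ((l+j : ℕ):ℝ)^j := by exact_mod_cast Nat.choose_le_pow (l+j) j
  have h3 : (n.choose j : ℝ) ≤ (n:ℝ)^j := by exact_mod_cast Nat.choose_le_pow n j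
  rw [h1]
  calc ((l+j).choose j : ℝ) * (n.choose j) * 2 ^ (l.choose 2) ≤ ((l+j : ℕ):ℝ)^j * (n:ℝ)^j * 2 ^ (l.choose 2) := by gcongr
    _ = 2 ^ (l.choose 2) * (((l+j : ℕ):ℝ) * n) ^ j := by rw [mul_pow]; ring
    _ ≤ _ := by
      gcongr
      have hle : Qc ^ (6 * (l+j)) / Qc^2 ≤ Qc ^ (4 * (2*l + j - 1)) := by
        rw [div_le_iff₀ (by positivity), ← pow_add]
        apply pow_le_pow_right₀ Qc_gt.le
        omega
      refine le_trans ?_ hle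
      rw [le_div_iff₀ (by positivity)]
      rw [div_le_one (by positivity)] at hk
      have e : Qc ^ (6 * (l+j)) = Qc ^ (4 * (l+j)) * Qc ^ (2 * (l+j)) := by rw [← pow_add]; congr 1; ring
      rw [e]
      calc ((l+j : ℕ):ℝ) * n * Qc^2 ≤ ((l+j : ℕ):ℝ) * (2 * (l+j : ℕ) * Qc ^ (4*(l+j))) * Qc^2 := by gcongr
        _ = Qc ^ (4*(l+j)) * (2 * ((l+j : ℕ):ℝ)^2 * Qc^2) := by ring
        _ ≤ _ := by gcongr

lemma var_bound : ∀ᶠ k : ℕ in atTop, ∀ n : ℕ, (0.841:ℝ) / Real.exp 1 * k * Qc ^ (4*k) ≤ n →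
    (n:ℝ) ≤ 2 * k * Qc ^ (4*k) → ∀ t : ℕ, 
    Pr n (fun G => G.Colorable t) ≤ Pr (n+k) (fun G => G.Colorable (t+1)) + (k:ℝ)^2 / Qc ^ k := by
  have hQ := Qc_pos
  have hx0 : (0:ℝ) ≤ (Qc^2)⁻¹ := by positivity
  have hx1 : (Qc^2)⁻¹ < 1 := inv_lt_one_of_one_lt₀ (one_lt_pow₀ Qc_gt (by norm_num))
  have E1 := poly_small 1 4 _ hx0 hx1 1 one_pos
  have E2 := poly_small 2 (2 * Qc^2) _ hx0 hx1 1 one_pos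
  filter_upwards [E1, E2, eventually_ge_atTop 3] with k hk1 hk2 hk3 n hn1 hn2 t
  have e1 : 4 * (k:ℝ) / Qc ^ (2*k) ≤ 1 := by
    rw [pow_mul, div_eq_mul_inv, ← inv_pow]; simpa using hk1
  have e2 : 2 * (k:ℝ)^2 * Qc^2 / Qc ^ (2*k) ≤ 1 := by
    rw [pow_mul, div_eq_mul_inv, ← inv_pow]; linarith
  have hk3' : (3:ℝ) ≤ k := by exact_mod_cast hk3
  have he := Real.exp_one_lt_d9
  have he2 := Real.exp_one_gt_d9
  have hn1' : (0.3:ℝ) * k * Qc ^ (4*k) ≤ n := by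
    refine le_trans ?_ hn1
    gcongr
    rw [le_div_iff₀ (by positivity)]
    linarith
  refine (step n k t).trans ?_
  gcongr
  have hsum : Wsum (n+k) k / ((n+k).choose k) ^ 2 ≤ (k:ℝ)^4 / Qc ^ (2*k) := by
    refine (Wsum_le n k).trans ?_
    have hterm : ∀ l ∈ Finset.Icc 2 k, (k.choose l : ℝ) * (n.choose (k-l)) * 2 ^ (l.choose 2) / ((n+k).choose k) ≤ (k:ℝ)^3 / Qc ^ (2*k) := by
      intro l hl
      rw [Finset.mem_Icc] at hl
      by_cases h : 2 * l ≤ k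
      · refine (small_term n k l hl.1 h hn1' e1).trans ?_
        rw [sq]
        calc 4 * (k:ℝ) / Qc ^ (2*k) * (4 * (k:ℝ) / Qc ^ (2*k)) ≤ 1 * (4 * (k:ℝ) / Qc ^ (2*k)) := by gcongr
          _ ≤ _ := by
            rw [one_mul]
            gcongr
            nlinarith [mul_le_mul hk3' hk3' (by norm_num) (by positivity)]
      · refine (big_term n k l hl.2 (by omega) hn2 e2).trans ((inv_mu n k (by omega) hn1).trans ?_)
        gcongr
        nlinarith [mul_le_mul hk3' hk3' (by norm_num) (by positivity)]
    refine (Finset.sum_le_card_nsmul _ _ _ hterm).trans ?_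
    rw [nsmul_eq_mul, Nat.card_Icc]
    calc ((k + 1 - 2 : ℕ) : ℝ) * ((k:ℝ)^3 / Qc ^ (2*k)) ≤ (k:ℝ) * ((k:ℝ)^3 / Qc ^ (2*k)) := by
          gcongr; omega
      _ = _ := by ring
  rw [Real.sqrt_le_left (by positivity), div_pow, ← pow_mul, ← pow_mul]
  rw [mul_comm k 2]
  exact hsum

lemma chain : ∀ᶠ k : ℕ in atTop, ∀ r n : ℕ, (0.841:ℝ) / Real.exp 1 * k * Qc ^ (4*k) ≤ n →
    ((n + r * k : ℕ):ℝ) ≤ 2 * k * Qc ^ (4*k) → ∀ t : ℕ, 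
    Pr n (fun G => G.Colorable t) ≤ Pr (n+r*k) (fun G => G.Colorable (t+r)) + r * ((k:ℝ)^2 / Qc ^ k) := by
  filter_upwards [var_bound] with k hk r
  induction r with
  | zero => 
    intro n _ _ t
    have e : n + 0 * k = n := by ring
    rw [e]; simp
  | succ r ih =>
    intro n h1 h2 t
    have e : n + (r+1) * k = n + k + r * k := by ring
    have e2 : t + (r+1) = t + 1 + r := by ring
    rw [e] at h2
    rw [e, e2]
    have a1 := hk n h1 (le_trans (by push_cast; nlinarith [(Nat.cast_nonneg r : (0:ℝ) ≤ r), (Nat.cast_nonneg k : (0:ℝ) ≤ k)]) h2) t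
    have a2 := ih (n+k) (h1.trans (by push_cast; linarith [(Nat.cast_nonneg k : (0:ℝ) ≤ k)])) h2 (t+1)
    push_cast
    linarith

lemma fm_log (N m : ℕ) (K : ℝ) (hK : 100000 ≤ K) (hm0 : 0 < m) (hmN : m ≤ N)
    (hm1 : (m:ℝ) ≤ N / (K - 2.884)) (hm2 : (N:ℝ) / (K - 2.884) - 1 ≤ m)
    (hN : Real.log N ≤ Real.log K + K * (Real.log 2 / 2) - 1) (hN2 : 0.0001 * (N:ℝ) ≥ K + 1) :
    Pr N (fun G => G.Colorable m) ≤ Real.exp (-1) := by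
  have h := first_moment N m hm0 hmN
  have hm0' : (0:ℝ) < m := by exact_mod_cast hm0
  have hN0' : (0:ℝ) < N := by exact_mod_cast (by omega : 0 < N)
  have hf : (0:ℝ) < m.factorial := by exact_mod_cast Nat.factorial_pos m
  rw [← le_div_iff₀ hf] at h
  refine h.trans ?_
  rw [div_le_iff₀ hf, ← Real.log_le_log_iff (by positivity) (by positivity), Real.log_mul (by positivity) (by positivity),
    Real.log_mul (by positivity) (by positivity), Real.log_pow, Real.log_rpow (by norm_num), Real.log_exp]
  have hst := Stirling.le_log_factorial_stirling (n := m) (by omega)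
  have hlm0 : 0 ≤ Real.log m := Real.log_natCast_nonneg m
  have hpi : 0 ≤ Real.log (2 * Real.pi) := Real.log_nonneg (by nlinarith [Real.pi_gt_three])
  have hl2 := Real.log_two_lt_d9
  have hl2' := Real.log_two_gt_d9
  set L := Real.log 2 / 2 with hL
  have hKκ : 0 < K - 2.884 := by linarith
  have hsq : (N:ℝ) * (K - 2.884) ≤ (N:ℝ)^2 / m := by
    rw [le_div_iff₀ hm0']
    rw [le_div_iff₀ hKκ] at hm1
    nlinarith
  have hlogm : Real.log m ≤ L * K - 1 + 3 / K := by
    have h1 : Real.log m ≤ Real.log (N / (K - 2.884)) := Real.log_le_log hm0' hm1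
    rw [Real.log_div (by positivity) (by positivity)] at h1
    have h2 : Real.log (K / (K - 2.884)) ≤ K / (K - 2.884) - 1 := Real.log_le_sub_one_of_pos (by positivity)
    rw [Real.log_div (by positivity) (by positivity)] at h2
    have h3 : K / (K - 2.884) - 1 ≤ 3 / K := by
      rw [div_sub_one (by positivity), div_le_div_iff₀ hKκ (by positivity)]
      nlinarith
    linarith
  have hmK : (N:ℝ) / K - 1 ≤ m := by
    refine le_trans ?_ hm2
    gcongr
    linarith
  have hmN' : (m:ℝ) ≤ N := by exact_mod_cast hmN
  have s1 : ((N:ℝ) - m) * Real.log m ≤ (N - m) * (L * K - 1 + 3 / K) := by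
    apply mul_le_mul_of_nonneg_left hlogm; linarith
  have hpos : 0 ≤ L * K - 2 + 3 / K := by
    have : 0 ≤ 3 / K := by positivity
    nlinarith
  have s2 : ((N:ℝ)/K - 1) * (L * K - 2 + 3/K) ≤ m * (L * K - 2 + 3 / K) := mul_le_mul_of_nonneg_right hmK hpos
  have s3 : -(((N:ℝ)^2 / m - N)/2) * Real.log 2 ≤ - (L * N * (K - 2.884 - 1)) := by
    have : L * (N * (K - 2.884)) ≤ L * ((N:ℝ)^2 / m) := by
      apply mul_le_mul_of_nonneg_left hsq; linarith
    have e : -(((N:ℝ)^2 / m - N)/2) * Real.log 2 = L * N - L * ((N:ℝ)^2 / m) := by rw [hL]; ring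
    rw [e]; linarith
  have s4 : ((N:ℝ)/K - 1) * (L * K - 2 + 3/K) ≥ N * L - N * (2 / K) - L * K - 1 := by
    have e : ((N:ℝ)/K - 1) * (L * K - 2 + 3/K) = N * L - N * (2 / K) - L * K + 2 + N / K * (3/K) - 3/K := by
      field_simp; ring
    rw [e]
    have : 3 / K ≤ 1 := by rw [div_le_one (by positivity)]; linarith
    have : 0 ≤ (N:ℝ) / K * (3/K) := by positivity
    linarith
  have s5 : (N:ℝ) * (2/K) ≤ N * 0.00002 := by
    gcongr
    rw [div_le_iff₀ (by positivity)]; linarith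
  have s6 : (N:ℝ) * (3/K) ≤ N * 0.00003 := by
    gcongr
    rw [div_le_iff₀ (by positivity)]; linarith
  have s7 : L * (N * 2.884) ≤ 0.9996 * N := by nlinarith
  have s8 : L * K ≤ 0.35 * K := by nlinarith
  clear hsq hm1 hm2 hN hmK hlogm h
  linarith

lemma Qc4_log (K : ℕ) : Real.log (Qc ^ (4*K)) = K * (Real.log 2 / 2) := by
  have : Real.log (Qc ^ 8) = Real.log 2 := by rw [Qc_pow]
  rw [Real.log_pow] at this ⊢
  push_cast at this ⊢
  linear_combination (K/2) * this

lemma Qc4_tendsto (C : ℝ) : ∀ᶠ K : ℕ in atTop, C ≤ Qc ^ (4*K) := by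
  have : Tendsto (fun K : ℕ => (Qc^4)^K) atTop atTop := tendsto_pow_atTop_atTop_of_one_lt (one_lt_pow₀ Qc_gt (by norm_num))
  filter_upwards [this.eventually_ge_atTop C] with K hK
  rw [pow_mul]; exact hK

lemma lower : ∀ᶠ K : ℕ in atTop, ∀ N m : ℕ, N = ⌊(K:ℝ) * Qc ^ (4*K) / Real.exp 1⌋₊ → 
    m = ⌊(N:ℝ) / (K - 2.884)⌋₊ → Pr N (fun G => G.Colorable m) ≤ Real.exp (-1) := by
  filter_upwards [eventually_ge_atTop 100000, Qc4_tendsto 60000] with K hK hQ N m hN hm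
  have hK' : (100000:ℝ) ≤ K := by exact_mod_cast hK
  have hK0 : (0:ℝ) < K := by linarith
  have he := Real.exp_one_lt_d9
  have hQ0 := Qc_pos
  have hX : (20000:ℝ) * K ≤ (K:ℝ) * Qc ^ (4*K) / Real.exp 1 := by
    rw [le_div_iff₀ (by positivity)]
    calc (20000:ℝ) * K * Real.exp 1 ≤ 20000 * K * 3 := by gcongr; linarith
      _ = K * 60000 := by ring
      _ ≤ _ := by gcongr
  have hNle : (N:ℝ) ≤ (K:ℝ) * Qc ^ (4*K) / Real.exp 1 := by
    rw [hN]; exact Nat.floor_le (by positivity)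
  have hNge : (K:ℝ) * Qc ^ (4*K) / Real.exp 1 - 1 ≤ N := by
    rw [hN]; exact (Nat.sub_one_lt_floor _).le
  have hNpos : (0:ℝ) < N := by linarith
  have hKκ : (0:ℝ) < K - 2.884 := by linarith
  have hm1 : (m:ℝ) ≤ N / (K - 2.884) := by rw [hm]; exact Nat.floor_le (by positivity)
  have hm2 : (N:ℝ) / (K - 2.884) - 1 ≤ m := by rw [hm]; exact (Nat.sub_one_lt_floor _).le
  apply fm_log N m K hK' _ _ hm1 hm2
  · have h1 := Real.log_le_log hNpos hNle
    rw [Real.log_div (by positivity) (by positivity), Real.log_mul (by positivity) (by positivity), Qc4_log, Real.log_exp] at h1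
    exact h1
  · linarith
  · have : (1:ℝ) < m := by
      have : (2:ℝ) < N / (K - 2.884) := by
        rw [lt_div_iff₀ hKκ]; linarith
      linarith
    exact_mod_cast (by linarith : (0:ℝ) < m)
  · have : (m:ℝ) ≤ N := hm1.trans (div_le_self hNpos.le (by linarith))
    exact_mod_cast this

lemma col_iff (n : ℕ) (G : SimpleGraph (Fin n)) (m : ℕ) : G.Colorable m ↔ chi n G ≤ m := by
  unfold chi
  have hfin : G.chromaticNumber ≠ ⊤ := by
    rw [SimpleGraph.chromaticNumber_ne_top_iff_exists]
    exact ⟨_, G.colorable_of_fintype⟩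
  rw [← SimpleGraph.chromaticNumber_le_iff_colorable]
  obtain ⟨a, ha⟩ := ENat.ne_top_iff_exists.1 hfin
  rw [← ha]; simp

lemma Pr_inter (n : ℕ) (A B : SimpleGraph (Fin n) → Prop) (h : 1 < Pr n A + Pr n B) : ∃ G, A G ∧ B G := by
  classical
  by_contra hcon
  push Not at hcon
  have hΩ := card_graph_pos n
  unfold Pr at h
  rw [← add_div, lt_div_iff₀ hΩ, one_mul, card_sum, card_sum, ← Finset.sum_add_distrib] at h
  have h2 : (Nat.card (SimpleGraph (Fin n)) : ℝ) = ∑ G : SimpleGraph (Fin n), (1:ℝ) := by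
    simp [Nat.card_eq_fintype_card]
  rw [h2] at h
  apply absurd h
  rw [not_lt]
  apply Finset.sum_le_sum
  intro G _
  by_cases hA : A G
  · simp [hA, hcon G hA]
  · simp only [hA, if_false, zero_add]; split_ifs <;> simp

lemma Pr_mono (n : ℕ) (A B : SimpleGraph (Fin n) → Prop) (h : ∀ G, A G → B G) : Pr n A ≤ Pr n B := by
  classical
  unfold Pr
  rw [card_sum, card_sum]
  gcongr with G
  by_cases hA : A G
  · simp [hA, h G hA]
  · simp only [hA, if_false]; split_ifs <;> simp

lemma Pr_compl (n : ℕ) (A : SimpleGraph (Fin n) → Prop) : Pr n A + Pr n (fun G => ¬ A G) = 1 := by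
  classical
  have hΩ := card_graph_pos n
  have h2 : (Nat.card (SimpleGraph (Fin n)) : ℝ) = ∑ G : SimpleGraph (Fin n), (1:ℝ) := by
    simp [Nat.card_eq_fintype_card]
  unfold Pr
  rw [← add_div, div_eq_one_iff_eq hΩ.ne', card_sum, card_sum, ← Finset.sum_add_distrib, h2]
  apply Finset.sum_congr rfl
  intro G _
  by_cases hA : A G <;> simp [hA]

lemma rpow_bound (c : ℝ) (hc0 : 0 < c) (hc : c < 1/4) (n k : ℕ) (hk : 1 ≤ k) (hn : (n:ℝ) ≤ 2 * k * Qc ^ (4*k)) :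
    (n:ℝ) ^ c ≤ 2 * k * (Qc ^ (4 * c)) ^ k := by
  have hQ := Qc_pos
  have hk' : (1:ℝ) ≤ k := by exact_mod_cast hk
  calc (n:ℝ) ^ c ≤ (2 * k * Qc ^ (4*k)) ^ c := Real.rpow_le_rpow (by positivity) hn hc0.le
    _ = (2 * (k:ℝ)) ^ c * (Qc ^ (4*k)) ^ c := Real.mul_rpow (by positivity) (by positivity)
    _ ≤ 2 * k * (Qc ^ (4 * c)) ^ k := by
      gcongr
      · calc (2 * (k:ℝ)) ^ c ≤ (2 * (k:ℝ)) ^ (1:ℝ) := Real.rpow_le_rpow_of_exponent_le (by linarith) (by linarith)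
          _ = _ := Real.rpow_one _
      · apply le_of_eq
        rw [← Real.rpow_natCast, ← Real.rpow_natCast, ← Real.rpow_mul hQ.le, ← Real.rpow_mul hQ.le]
        congr 1
        push_cast; ring

lemma jump (s t : ℕ → ℝ) (x : ℝ) (hx1 : 1 < x) (hxQ : x < Qc) (n1 : ℕ)
    (hP : ∀ n, n1 ≤ n → 0.9 < Pr n (fun G => (chi n G : ℝ) ∈ Set.Icc (s n) (t n))) :
    ∀ᶠ k : ℕ in atTop, ∀ n : ℕ, (0.8415:ℝ) / Real.exp 1 * k * Qc ^ (4*k) ≤ n →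
    (n:ℝ) ≤ 2 * k * Qc ^ (4*k) → ⌊x^k⌋₊ * k ≤ n ∧ s n ≤ t (n - ⌊x^k⌋₊ * k) + ⌊x^k⌋₊ := by
  have hQ := Qc_pos
  have hQ1 := Qc_gt
  have hxq : x / Qc < 1 := by rw [div_lt_one hQ]; exact hxQ
  have hxq4 : x / Qc^4 < 1 := by
    rw [div_lt_one (by positivity)]
    refine hxQ.trans ?_
    calc Qc = Qc^1 := (pow_one _).symm
      _ < Qc^4 := pow_lt_pow_right₀ hQ1 (by norm_num)
  have E1 := poly_small 2 1 _ (by positivity) hxq 0.1 (by norm_num)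
  have E2 := poly_small 0 1 _ (by positivity) hxq4 (0.0005 / Real.exp 1) (by positivity)
  filter_upwards [E1, E2, chain, Qc4_tendsto (n1 * 4), eventually_ge_atTop 1] with k hk1 hk2 hk3 hk4 hk5 n hn1 hn2
  have hk5' : (1:ℝ) ≤ k := by exact_mod_cast hk5
  set r := ⌊x^k⌋₊ with hr
  have hrx : (r:ℝ) ≤ x^k := Nat.floor_le (by positivity)
  have he := Real.exp_one_lt_d9
  have e1 : (r:ℝ) * k ≤ 0.0005 / Real.exp 1 * k * Qc ^ (4*k) := by
    rw [div_pow, pow_zero, one_mul, one_mul, div_le_iff₀ (by positivity), ← pow_mul] at hk2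
    calc (r:ℝ) * k ≤ (0.0005 / Real.exp 1 * Qc ^ (4*k)) * k := by gcongr; linarith
      _ = _ := by ring
  have e2 : (0.8415:ℝ) / Real.exp 1 * k * Qc ^ (4*k) = 0.841 / Real.exp 1 * k * Qc ^ (4*k) + 0.0005 / Real.exp 1 * k * Qc ^ (4*k) := by ring
  have hpos : 0 ≤ (0.841:ℝ) / Real.exp 1 * k * Qc ^ (4*k) := by positivity
  have hle : r * k ≤ n := by
    have : ((r * k : ℕ):ℝ) ≤ n := by push_cast; linarith
    exact_mod_cast this
  refine ⟨hle, ?_⟩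
  obtain ⟨n', rfl⟩ : ∃ n', n = n' + r * k := ⟨n - r * k, by omega⟩
  rw [Nat.add_sub_cancel]
  have hn' : (0.841:ℝ) / Real.exp 1 * k * Qc ^ (4*k) ≤ n' := by
    push_cast at hn1; linarith
  have hn1' : n1 ≤ n' := by
    have h1 : (n1:ℝ) ≤ (0.841:ℝ) / Real.exp 1 * k * Qc ^ (4*k) := by
      have h2 : (0.25:ℝ) ≤ 0.841 / Real.exp 1 := by
        rw [le_div_iff₀ (by positivity)]; linarith
      calc (n1:ℝ) = 0.25 * 1 * (n1 * 4) := by ring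
        _ ≤ _ := by gcongr
    exact_mod_cast h1.trans hn'
  have p1 := hP n' hn1'
  have p2 := hP (n' + r * k) (by omega)
  have ht0 : 0 ≤ t n' := by
    obtain ⟨G, hG, _⟩ := Pr_inter n' _ _ (by linarith : 1 < Pr n' (fun G => (chi n' G : ℝ) ∈ Set.Icc (s n') (t n')) + Pr n' (fun G => (chi n' G : ℝ) ∈ Set.Icc (s n') (t n')))
    exact le_trans (Nat.cast_nonneg _) hG.2
  have p3 : 0.9 < Pr n' (fun G => G.Colorable ⌊t n'⌋₊) := by
    refine p1.trans_le (Pr_mono _ _ _ ?_)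
    intro G hG
    rw [col_iff]
    exact Nat.le_floor hG.2
  have p4 := hk3 r n' hn' hn2 ⌊t n'⌋₊
  have e3 : (r:ℝ) * ((k:ℝ)^2 / Qc ^ k) ≤ 0.1 := by
    calc (r:ℝ) * ((k:ℝ)^2 / Qc ^ k) ≤ x^k * ((k:ℝ)^2 / Qc ^ k) := by gcongr
      _ = 1 * (k:ℝ)^2 * (x / Qc)^k := by rw [div_pow]; ring
      _ ≤ _ := hk1
  obtain ⟨G, hG1, hG2⟩ := Pr_inter _ _ _ (by linarith : 1 < Pr (n' + r*k) (fun G => G.Colorable (⌊t n'⌋₊ + r)) + Pr (n' + r*k) (fun G => (chi (n' + r*k) G : ℝ) ∈ Set.Icc (s (n'+r*k)) (t (n'+r*k))))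
  rw [col_iff] at hG1
  have h5 : (chi (n' + r*k) G : ℝ) ≤ (⌊t n'⌋₊ : ℝ) + r := by exact_mod_cast hG1
  have h6 := Nat.floor_le ht0
  linarith [hG2.1]

/-- supporting lines -/
noncomputable def ell (j : ℕ) (n : ℝ) : ℝ := n / (j - 0.001) + 2.875 / Real.exp 1 * Qc ^ (4*j) / j

lemma Qc4_bounds : 1.41421 ≤ Qc^4 ∧ Qc^4 ≤ 1.5 := by
  have h : (Qc^4)^2 = 2 := by rw [← pow_mul]; exact Qc_pow
  have hp : 0 < Qc^4 := by have := Qc_pos; positivity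
  constructor <;> nlinarith

lemma ell_hi (k : ℕ) (hk : 2 ≤ k) (n : ℝ) (hn : 0 ≤ n) (h : ell k n ≤ ell (k+1) n) : n ≤ 2 * k * Qc ^ (4*k) := by
  have hQ := Qc_pos
  have hk' : (2:ℝ) ≤ k := by exact_mod_cast hk
  have hb := Qc4_bounds
  have he := Real.exp_one_gt_d9
  unfold ell at h
  push_cast at h
  have e : Qc ^ (4*(k+1)) = Qc ^ (4*k) * Qc^4 := by rw [← pow_add]; rfl
  rw [e] at h
  set X := Qc ^ (4*k) with hX
  have hX0 : 0 < X := by positivity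
  have h1 : n / (k * (k+1)) ≤ n / (k - 0.001) - n / (k + 1 - 0.001) := by
    rw [div_sub_div _ _ (by linarith) (by linarith)]
    have : n * ((k:ℝ) + 1 - 0.001) - (k - 0.001) * n = n := by ring
    rw [this]
    apply div_le_div_of_nonneg_left hn (mul_pos (by linarith) (by linarith))
    nlinarith
  have h2 : 0 ≤ 2.875 / Real.exp 1 * X / k := by positivity
  have h3 : 2.875 / Real.exp 1 * (X * Qc^4) / (k+1) ≤ 2 * X / (k+1) := by
    apply div_le_div_of_nonneg_right _ (by positivity)
    have h4 : 2.875 / Real.exp 1 ≤ 1.2 := by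
      rw [div_le_iff₀ (by positivity)]; linarith
    calc 2.875 / Real.exp 1 * (X * Qc^4) ≤ 1.2 * (X * 1.5) := by gcongr; exact hb.2
      _ ≤ _ := by linarith
  have h5 : n / (k * (k+1)) ≤ 2 * X / (k+1) := by linarith
  rw [div_le_div_iff₀ (by positivity) (by positivity)] at h5
  have h6 : n * ((k:ℝ)+1) ≤ (2 * k * X) * (k+1) := by linarith
  exact le_of_mul_le_mul_right h6 (by linarith)

lemma ell_lo (k : ℕ) (hk : 100000 ≤ k) (n : ℝ) (hn : 0 ≤ n) (h : ell (k+1) n ≤ ell k n) :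
    0.8415 / Real.exp 1 * (k+1 : ℕ) * Qc ^ (4*(k+1)) ≤ n := by
  have hQ := Qc_pos
  have hk' : (100000:ℝ) ≤ k := by exact_mod_cast hk
  have hb := Qc4_bounds
  unfold ell at h
  push_cast at h ⊢
  have e : Qc ^ (4*k) = Qc ^ (4*(k+1)) / Qc^4 := by
    rw [eq_div_iff (by positivity), ← pow_add]; rfl
  rw [e] at h
  set X := Qc ^ (4*(k+1)) / Real.exp 1 with hX
  have hX0 : 0 < X := by positivity
  have h1 : n / (k - 0.001) - n / (k + 1 - 0.001) = n / ((k - 0.001) * (k + 1 - 0.001)) := by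
    rw [div_sub_div _ _ (by linarith) (by linarith)]
    congr 1; ring
  have e2 : 2.875 / Real.exp 1 * Qc ^ (4*(k+1)) / ((k:ℝ)+1) = 2.875 * X / (k+1) := by rw [hX]; ring
  have e3 : 2.875 / Real.exp 1 * (Qc ^ (4*(k+1)) / Qc^4) / (k:ℝ) = 2.875 * X / Qc^4 / k := by rw [hX]; ring
  rw [e2, e3] at h
  have h2 : 2.875 * X / Qc^4 / k ≤ 2.875 * X * 0.70711 / k := by
    gcongr
    rw [div_le_iff₀ (by positivity)]
    nlinarith
  have h3 : 2.875 * X / (k+1) - 2.875 * X * 0.70711 / k ≤ n / ((k - 0.001) * (k + 1 - 0.001)) := by linarith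
  have h4 : 2.875 * X / (k+1) - 2.875 * X * 0.70711 / k = 2.875 * X * (0.29289 * k - 0.70711) / ((k+1) * k) := by
    field_simp; ring
  have hpp : (0:ℝ) < (k - 0.001) * (k + 1 - 0.001) := mul_pos (by linarith) (by linarith)
  rw [h4, div_le_div_iff₀ (by positivity) hpp] at h3
  have e4 : 0.8415 / Real.exp 1 * ((k:ℝ) + 1) * Qc ^ (4*(k+1)) = X * (0.8415 * (k+1)) := by rw [hX]; ring
  rw [e4]
  have h5 : (0.8415 * ((k:ℝ)+1)) * ((k+1) * k) ≤ 2.875 * (0.29289 * k - 0.70711) * ((k - 0.001) * (k + 1 - 0.001)) := by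
    obtain ⟨d, hd, hd0⟩ : ∃ d : ℝ, (k:ℝ) = d + 100000 ∧ 0 ≤ d := ⟨k - 100000, by ring, by linarith⟩
    rw [hd]
    have : 0 ≤ d^2 := by positivity
    have : 0 ≤ d^3 := by positivity
    nlinarith
  have h6 : X * (0.8415 * (k+1)) * ((k+1) * k) ≤ n * ((k+1) * k) := by
    calc X * (0.8415 * (k+1)) * ((k+1) * k) = X * ((0.8415 * ((k:ℝ)+1)) * ((k+1) * k)) := by ring
      _ ≤ X * (2.875 * (0.29289 * k - 0.70711) * ((k - 0.001) * (k + 1 - 0.001))) := by gcongr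
      _ ≤ _ := by linarith
  exact le_of_mul_le_mul_right h6 (by positivity)

lemma ell_min (n : ℝ) (hn : 0 ≤ n) : ∃ k, 2 ≤ k ∧ ∀ j, 2 ≤ j → ell k n ≤ ell j n := by
  have hQ := Qc_pos
  have hT : Tendsto (fun i : ℕ => ell (i+2) n) cofinite atTop := by
    rw [Nat.cofinite_eq_atTop]
    rw [tendsto_atTop]
    intro b
    have h4 : (Qc^4)⁻¹ < 1 := inv_lt_one_of_one_lt₀ (one_lt_pow₀ Qc_gt (by norm_num))
    have E := poly_small 1 (max b 1) _ (by positivity) h4 1 one_pos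
    filter_upwards [(tendsto_add_atTop_nat 2).eventually E] with a ha
    unfold ell
    set k := a + 2 with hk
    have hk2 : (2:ℝ) ≤ k := by rw [hk]; push_cast; linarith [(Nat.cast_nonneg a : (0:ℝ) ≤ a)]
    rw [pow_one, inv_pow, ← pow_mul, ← div_eq_mul_inv, div_le_one (by positivity)] at ha
    have h1 : 0 ≤ n / ((k:ℝ) - 0.001) := div_nonneg hn (by linarith)
    have h2 : max b 1 ≤ Qc ^ (4*k) / k := by
      rw [le_div_iff₀ (by linarith)]; exact ha
    have he := Real.exp_one_lt_d9
    have h3 : 1 ≤ 2.875 / Real.exp 1 := by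
      rw [le_div_iff₀ (by positivity)]; linarith
    have h5 : 0 ≤ Qc ^ (4*k) / k := by positivity
    have h6 : 2.875 / Real.exp 1 * Qc ^ (4*k) / k = 2.875 / Real.exp 1 * (Qc ^ (4*k) / k) := by ring
    rw [h6]
    have h7 := le_max_left b 1
    nlinarith
  obtain ⟨i, hi⟩ := hT.exists_forall_le
  refine ⟨i+2, by omega, fun j hj => ?_⟩
  obtain ⟨i', rfl⟩ : ∃ i', j = i' + 2 := ⟨j - 2, by omega⟩
  exact hi i'

lemma ell_nonneg (j : ℕ) (hj : 2 ≤ j) (n : ℝ) (hn : 0 ≤ n) : 0 ≤ ell j n := by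
  have hQ := Qc_pos
  have hj' : (2:ℝ) ≤ j := by exact_mod_cast hj
  have h1 : 0 ≤ n / ((j:ℝ) - 0.001) := div_nonneg hn (by linarith)
  have h2 : 0 ≤ 2.875 / Real.exp 1 * Qc ^ (4*j) / j := by positivity
  unfold ell; linarith

lemma upper (c : ℝ) (hc0 : 0 < c) (hc : c < 1/4)
    (s t : ℕ → ℝ) (hlen : ∀ n : ℕ, t n - s n ≤ (n : ℝ) ^ c) (n1 : ℕ)
    (hP : ∀ n, n1 ≤ n → 0.9 < Pr n (fun G => (chi n G : ℝ) ∈ Set.Icc (s n) (t n)))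
    (y : ℝ) (hy : y = Qc ^ (4*c)) (hy1 : 1 < y) (hyQ : y < Qc) :
    ∃ C0 : ℝ, 0 ≤ C0 ∧ ∀ n : ℕ, ∀ j, 2 ≤ j → s n ≤ C0 + ell j n := by
  have hQ := Qc_pos
  have hQ1 := Qc_gt
  obtain ⟨x, hyx, hxQ⟩ := exists_between hyQ
  have hx1 : 1 < x := hy1.trans hyx
  have hyx1 : y / x < 1 := by rw [div_lt_one (by linarith)]; exact hyx
  have E := poly_small 2 4000 (y/x) (by positivity) hyx1 1 one_pos
  obtain ⟨K0, hK0⟩ := eventually_atTop.1 ((jump s t x hx1 hxQ n1 hP).and (E.and (eventually_ge_atTop 100001)))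
  set n2 := ⌊2 * (K0:ℝ) * Qc ^ (4*K0)⌋₊ + 1 with hn2
  refine ⟨∑ i ∈ Finset.range n2, |s i|, Finset.sum_nonneg (fun i _ => abs_nonneg _), ?_⟩
  set C0 := ∑ i ∈ Finset.range n2, |s i| with hC0
  intro n
  induction n using Nat.strong_induction_on with
  | _ n ih =>
  intro j hj
  have hn0 : (0:ℝ) ≤ n := Nat.cast_nonneg n
  rcases lt_or_ge n n2 with hlt | hge
  · have h1 : |s n| ≤ C0 := Finset.single_le_sum (f := fun i => |s i|) (fun i _ => abs_nonneg _) (Finset.mem_range.2 hlt)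
    have h2 := ell_nonneg j hj n hn0
    linarith [le_abs_self (s n)]
  obtain ⟨k, hk2, hkmin⟩ := ell_min n hn0
  have hhi := ell_hi k hk2 n hn0 (hkmin (k+1) (by omega))
  have hkK : K0 ≤ k := by
    by_contra hcon
    push Not at hcon
    have h1 : 2 * (k:ℝ) * Qc ^ (4*k) ≤ 2 * (K0:ℝ) * Qc ^ (4*K0) := by
      gcongr
      exact hQ1.le
    have h2 : 2 * (K0:ℝ) * Qc ^ (4*K0) < n2 := by rw [hn2]; push_cast; exact Nat.lt_floor_add_one _
    have h3 : (n2:ℝ) ≤ n := by exact_mod_cast hge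
    linarith
  obtain ⟨hjump, hE, hbig⟩ := hK0 k hkK
  have hlo : (0.8415:ℝ) / Real.exp 1 * k * Qc ^ (4*k) ≤ n := by
    obtain ⟨k', rfl⟩ : ∃ k', k = k' + 1 := ⟨k - 1, by omega⟩
    exact ell_lo k' (by omega) n hn0 (hkmin k' (by omega))
  obtain ⟨hrk, hs⟩ := hjump n hlo hhi
  have hxk : 1 ≤ x^k := one_le_pow₀ hx1.le
  have hr1 : 1 ≤ ⌊x^k⌋₊ := (Nat.one_le_floor_iff _).2 hxk
  have hrx : x^k < (⌊x^k⌋₊:ℝ) + 1 := Nat.lt_floor_add_one _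
  set r := ⌊x^k⌋₊ with hr
  have hr1' : (1:ℝ) ≤ r := by exact_mod_cast hr1
  have hk' : (100001:ℝ) ≤ k := by exact_mod_cast hbig
  obtain ⟨n', rfl⟩ : ∃ n', n = n' + r * k := ⟨n - r * k, by omega⟩
  rw [Nat.add_sub_cancel] at hs
  have hrkpos : 0 < r * k := Nat.mul_pos hr1 (by omega)
  have hn'0 : (0:ℝ) ≤ n' := Nat.cast_nonneg n'
  have hnc : (n':ℝ)^c ≤ 0.001 * r / k := by
    have h1 := rpow_bound c hc0 hc n' k (by omega) (by
      refine le_trans ?_ hhi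
      push_cast
      have : (0:ℝ) ≤ (r:ℝ) * k := by positivity
      linarith)
    rw [← hy] at h1
    refine h1.trans ?_
    rw [div_pow, mul_div_assoc', div_le_one (by positivity)] at hE
    rw [le_div_iff₀ (by linarith)]
    nlinarith
  have hs2 : s (n' + r*k) ≤ s n' + 0.001 * r / k + r := by linarith [hlen n']
  have key : (r:ℝ) + 0.001 * r / k ≤ r * k / (k - 0.001) := by
    rw [le_div_iff₀ (by linarith)]
    have e : ((r:ℝ) + 0.001 * r / k) * (k - 0.001) = r * k - 0.001 * 0.001 * r / k := by field_simp; ring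
    rw [e]
    have : 0 ≤ 0.001 * 0.001 * (r:ℝ) / k := by positivity
    linarith
  have main : ∀ i, 2 ≤ i → i ≤ k → s (n' + r*k) ≤ C0 + ell i ((n' + r*k : ℕ):ℝ) := by
    intro i hi hik
    have h1 := ih n' (by omega) i hi
    have hi' : (2:ℝ) ≤ i := by exact_mod_cast hi
    have hik' : (i:ℝ) ≤ k := by exact_mod_cast hik
    have h2 : ell i ((n' + r*k : ℕ):ℝ) = ell i n' + r * k / (i - 0.001) := by
      unfold ell; push_cast; ring
    have h3 : (r:ℝ) * k / (k - 0.001) ≤ r * k / (i - 0.001) := by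
      apply div_le_div_of_nonneg_left (by positivity) (by linarith) (by linarith)
    rw [h2]; linarith
  rcases le_or_gt j k with hjk | hjk
  · exact main j hj hjk
  · exact (main k hk2 le_rfl).trans (by linarith [hkmin j hj])

set_option maxHeartbeats 1000000 in
/-- For any constant `c < 1/4`, there is no sequence of intervals of length `n^c`
containing `χ(G(n,1/2))` with high probability. -/
theorem stmt0 (c : ℝ) (hc0 : 0 < c) (hc : c < 1/4)
    (s t : ℕ → ℝ) (hlen : ∀ n : ℕ, t n - s n ≤ (n : ℝ) ^ c) :
    ¬ Tendsto (fun n : ℕ => Pr n (fun G => (chi n G : ℝ) ∈ Set.Icc (s n) (t n)))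
      atTop (nhds 1) := by
  intro h
  have hQ := Qc_pos
  have hQ1 := Qc_gt
  obtain ⟨n1, hP⟩ := eventually_atTop.1 (h.eventually (lt_mem_nhds (by norm_num : (0.9:ℝ) < 1)))
  obtain ⟨y, hy⟩ : ∃ y, y = Qc ^ (4*c) := ⟨_, rfl⟩
  have hy1 : 1 < y := by rw [hy]; exact Real.one_lt_rpow hQ1 (by linarith)
  have hyQ : y < Qc := by
    rw [hy]
    calc Qc ^ (4*c) < Qc ^ (1:ℝ) := Real.rpow_lt_rpow_of_exponent_lt hQ1 (by linarith)
      _ = Qc := Real.rpow_one _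
  obtain ⟨C0, hC0, hup⟩ := upper c hc0 hc s t hlen n1 hP y hy hy1 hyQ
  have h4 : (Qc^4)⁻¹ < 1 := inv_lt_one_of_one_lt₀ (one_lt_pow₀ hQ1 (by norm_num))
  have hy4 : y / Qc^4 < 1 := by
    rw [div_lt_one (by positivity)]
    refine hyQ.trans ?_
    calc Qc = Qc^1 := (pow_one _).symm
      _ < Qc^4 := pow_lt_pow_right₀ hQ1 (by norm_num)
  have E1 := poly_small 1 (C0 + 5) _ (by positivity) h4 0.001 (by norm_num)
  have E2 := poly_small 2 2 _ (by positivity) hy4 0.001 (by norm_num)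
  obtain ⟨K, hK1, hK2, hK3, hK4, hK5⟩ := (E1.and (E2.and (lower.and ((Qc4_tendsto ((n1+1) * 3)).and (eventually_ge_atTop 10))))).exists
  have hK' : (10:ℝ) ≤ K := by exact_mod_cast hK5
  have he1 := Real.exp_one_gt_d9
  have he2 := Real.exp_one_lt_d9
  set X := Qc ^ (4*K) with hX
  have hX0 : 0 < X := by positivity
  obtain ⟨N, hN⟩ : ∃ N, N = ⌊(K:ℝ)*X/Real.exp 1⌋₊ := ⟨_, rfl⟩
  obtain ⟨m, hm⟩ : ∃ m, m = ⌊(N:ℝ)/(K-2.884)⌋₊ := ⟨_, rfl⟩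
  have hlow := hK3 N m hN hm
  have hN1 : (N:ℝ) ≤ (K:ℝ)*X/Real.exp 1 := by rw [hN]; exact Nat.floor_le (by positivity)
  have hN2 : (K:ℝ)*X/Real.exp 1 < N + 1 := by rw [hN]; exact Nat.lt_floor_add_one _
  have hm2 : (N:ℝ)/(K-2.884) < m + 1 := by rw [hm]; exact Nat.lt_floor_add_one _
  have hNn1 : n1 ≤ N := by
    have h1 : ((n1:ℝ)+1) ≤ (K:ℝ)*X/Real.exp 1 := by
      rw [le_div_iff₀ (by positivity)]
      have : (0:ℝ) ≤ n1 := Nat.cast_nonneg _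
      nlinarith
    have : (n1:ℝ) < N + 1 := by linarith
    have : n1 < N + 1 := by exact_mod_cast this
    omega
  have hexp : Real.exp (-1) < 0.5 := by
    rw [Real.exp_neg, inv_lt_comm₀ (by positivity) (by norm_num)]
    norm_num; linarith
  have hcompl := Pr_compl N (fun G => G.Colorable m)
  have hPN := hP N hNn1
  obtain ⟨G, hG1, hG2⟩ := Pr_inter N _ _ (by linarith : 1 < Pr N (fun G => (chi N G : ℝ) ∈ Set.Icc (s N) (t N)) + Pr N (fun G => ¬ G.Colorable m))
  rw [col_iff] at hG2
  push Not at hG2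
  have hmt : (m:ℝ) < t N := lt_of_lt_of_le (by exact_mod_cast hG2) hG1.2
  have hu := hup N K (by omega)
  have hl := hlen N
  have hnc := rpow_bound c hc0 hc N K (by omega) (by
    refine hN1.trans ?_
    rw [div_le_iff₀ (by positivity)]
    have : 0 < (K:ℝ) * X := by positivity
    rw [← hX]
    nlinarith)
  rw [← hy] at hnc
  unfold ell at hu
  rw [← hX] at hu
  rw [div_pow, mul_div_assoc', ← pow_mul, ← hX, div_le_iff₀ hX0] at hK2
  rw [inv_pow, ← pow_mul, ← hX, pow_one, ← div_eq_mul_inv, div_le_iff₀ hX0] at hK1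
  have hdiff : 2.883 * (N:ℝ) / K^2 ≤ (N:ℝ)/(K-2.884) - (N:ℝ)/(K-0.001) := by
    rw [div_sub_div _ _ (by linarith) (by linarith)]
    have e : (N:ℝ) * (K - 0.001) - (K - 2.884) * N = 2.883 * N := by ring
    rw [e]
    apply div_le_div_of_nonneg_left (by positivity) (mul_pos (by linarith) (by linarith))
    nlinarith
  have hZ : 2.883 * (N:ℝ) / K^2 < C0 + 1 + 2.875 / Real.exp 1 * X / K + 2 * K * y^K := by linarith
  rw [div_lt_iff₀ (by positivity)] at hZ
  obtain ⟨W, hW⟩ : ∃ W, W = X / Real.exp 1 := ⟨_, rfl⟩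
  have hW1 : 0.3 * X ≤ W := by
    rw [hW, le_div_iff₀ (by positivity)]; nlinarith
  have e1 : (K:ℝ)*X/Real.exp 1 = K * W := by rw [hW]; ring
  rw [e1] at hN2
  have e2 : (C0 + 1 + 2.875 / Real.exp 1 * X / K + 2 * K * y^K) * (K:ℝ)^2
    = (C0+1) * K * K + 2.875 * W * K + (2 * (K:ℝ)^2 * y^K) * K := by
    rw [hW]; field_simp
  rw [e2] at hZ
  have h7 : (2 * (K:ℝ)^2 * y^K) * K ≤ 0.001 * X * K := by gcongr
  have h8 : ((C0 + 5) * K) * K ≤ 0.001 * X * K := by gcongr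
  have h9 : 0.3 * X * K ≤ W * K := by gcongr
  have h10 : 0 < X * K := by positivity
  have h11 : (1:ℝ) ≤ K * K := by nlinarith only [hK']
  have h12 : ((C0 + 5) * K) * K = (C0+1) * K * K + 4 * (K * K) := by ring
  linarith only [h7, h8, h9, h10, h11, h12, hZ, hN2]
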